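/- Let p, q ∈ (0,∞] and let b be slowly varying. Then ‖·‖_{(p,q,b)} satisfies property (P4), i.e. ‖χ_E‖_{(p,q,b)} < ∞ for every E ⊆ R with μ(E) < ∞, if and only if one of the following conditions holds: (1) p ∈ (1,∞); (2) p = 1 and ‖ t^{−1/q} b(t) χ_{(1,∞)}(t) ‖_{L^q(0,∞)} < ∞; (3) p = ∞ and ‖ t^{−1/q} b(t) χ_{(0,1)}(t) ‖_{L^q(0,∞)} < ∞. Furthermore, if none of these conditions is satisfied, then L^{(p,q,b)} = {0}. -/

import Mathlib

open MeasureTheory Set Filter ENNReal Topology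

noncomputable section

/-- `f ≈ g` on `S`: two-sided equivalence with positive constants. -/
def EquivOn (f g : ℝ → ℝ) (S : Set ℝ) : Prop :=
  ∃ c C : ℝ, 0 < c ∧ 0 < C ∧ ∀ t ∈ S, c * g t ≤ f t ∧ f t ≤ C * g t

/-- A measurable positive function on `(0,∞)` is slowly varying if for every `ε > 0`,
`t ^ ε * b t` is equivalent to a non-decreasing function and `t ^ (-ε) * b t` is
equivalent to a non-increasing function on `(0,∞)`. -/
def IsSlowlyVarying (b : ℝ → ℝ) : Prop :=
  Measurable b ∧ (∀ t ∈ Set.Ioi (0:ℝ), 0 < b t) ∧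
    ∀ ε : ℝ, 0 < ε →
      (∃ bp : ℝ → ℝ, MonotoneOn bp (Set.Ioi 0) ∧
        EquivOn (fun t => t ^ ε * b t) bp (Set.Ioi 0)) ∧
      (∃ bm : ℝ → ℝ, AntitoneOn bm (Set.Ioi 0) ∧
        EquivOn (fun t => t ^ (-ε) * b t) bm (Set.Ioi 0))

/-- The non-increasing rearrangement `f*` (with values in `ℝ≥0∞`). -/
def rearr {X : Type*} [MeasurableSpace X] (μ : Measure X) (f : X → ℝ) (t : ℝ) : ℝ≥0∞ :=
  sInf {s : ℝ≥0∞ | μ {x | s < ENNReal.ofReal |f x|} ≤ ENNReal.ofReal t}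

/-- The maximal function `f**(t) = (1/t) ∫₀ᵗ f*`. -/
def maxf {X : Type*} [MeasurableSpace X] (μ : Measure X) (f : X → ℝ) (t : ℝ) : ℝ≥0∞ :=
  (ENNReal.ofReal t)⁻¹ * ∫⁻ s in Set.Ioo (0:ℝ) t, rearr μ f s

/-- The `L^q` "norm" over a subset `S ⊆ ℝ` of an `ℝ≥0∞`-valued function. -/
def lqNorm (q : ℝ≥0∞) (S : Set ℝ) (g : ℝ → ℝ≥0∞) : ℝ≥0∞ :=
  if q = ∞ then essSup g (volume.restrict S)
  else (∫⁻ t in S, g t ^ q.toReal) ^ (1 / q.toReal)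

/-- The Lorentz–Karamata functional `‖f‖_{p,q,b}`. -/
def lkNorm {X : Type*} [MeasurableSpace X] (μ : Measure X) (p q : ℝ≥0∞) (b : ℝ → ℝ)
    (f : X → ℝ) : ℝ≥0∞ :=
  lqNorm q (Set.Ioi 0)
    (fun t => ENNReal.ofReal (t ^ (p⁻¹.toReal - q⁻¹.toReal) * b t) * rearr μ f t)

/-- The Lorentz–Karamata functional `‖f‖_{(p,q,b)}` defined via the maximal function. -/
def lkMaxNorm {X : Type*} [MeasurableSpace X] (μ : Measure X) (p q : ℝ≥0∞) (b : ℝ → ℝ)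
    (f : X → ℝ) : ℝ≥0∞ :=
  lqNorm q (Set.Ioi 0)
    (fun t => ENNReal.ofReal (t ^ (p⁻¹.toReal - q⁻¹.toReal) * b t) * maxf μ f t)

/-- The `L^q(0,∞)` norm of `t ^ (1/p - 1/q) * b t` restricted to `S`. -/
def weightNorm (p q : ℝ≥0∞) (b : ℝ → ℝ) (S : Set ℝ) : ℝ≥0∞ :=
  lqNorm q S (fun t => ENNReal.ofReal (t ^ (p⁻¹.toReal - q⁻¹.toReal) * b t))

/-- A measure is non-atomic. -/
def IsNonatomic {X : Type*} [MeasurableSpace X] (μ : Measure X) : Prop :=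
  ∀ s : Set X, MeasurableSet s → 0 < μ s →
    ∃ t, t ⊆ s ∧ MeasurableSet t ∧ 0 < μ t ∧ μ t < μ s

/-- `b̃(t) = ∫₀ᵗ s⁻¹ b(s) ds`. -/
def svTilde (b : ℝ → ℝ) (t : ℝ) : ℝ≥0∞ :=
  ∫⁻ s in Set.Ioo (0:ℝ) t, ENNReal.ofReal (s⁻¹ * b s)

/-- `b̃_∞(t) = esssup_{s ∈ (0,t)} b(s)`. -/
def svTildeSup (b : ℝ → ℝ) (t : ℝ) : ℝ≥0∞ :=
  essSup (fun s => ENNReal.ofReal (b s)) (volume.restrict (Set.Ioo (0:ℝ) t))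

/-- `b̂(t) = ∫_t^∞ s⁻¹ b(s) ds`. -/
def svHat (b : ℝ → ℝ) (t : ℝ) : ℝ≥0∞ :=
  ∫⁻ s in Set.Ioi t, ENNReal.ofReal (s⁻¹ * b s)

/-- `b̂_∞(t) = esssup_{s ∈ (t,∞)} b(s)`. -/
def svHatSup (b : ℝ → ℝ) (t : ℝ) : ℝ≥0∞ :=
  essSup (fun s => ENNReal.ofReal (b s)) (volume.restrict (Set.Ioi t))

/-- The associate functional of a functional `N`. -/
def assocNorm {X : Type*} [MeasurableSpace X] (μ : Measure X) (N : (X → ℝ) → ℝ≥0∞)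
    (f : X → ℝ) : ℝ≥0∞ :=
  ⨆ (g : X → ℝ) (_ : Measurable g) (_ : N g ≤ 1), ∫⁻ x, ENNReal.ofReal |f x * g x| ∂μ

/-- The conjugate exponent: `q' = q/(q-1)` for `q ∈ (1,∞)`, `1' = ∞`, `∞' = 1`. -/
def conjE (q : ℝ≥0∞) : ℝ≥0∞ := (1 - q⁻¹)⁻¹

/-- The interval `(0, μ(R))` inside `ℝ`, where `μ(R)` may be infinite. -/
def IooMu {X : Type*} [MeasurableSpace X] (μ : Measure X) : Set ℝ :=
  {t : ℝ | 0 < t ∧ ENNReal.ofReal t < μ Set.univ}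

/-- The embedding `L^{p₁,q₁,b₁} ↪ L^{p₂,q₂,b₂}`. -/
def lkEmbed {X : Type*} [MeasurableSpace X] (μ : Measure X) (p1 q1 : ℝ≥0∞) (b1 : ℝ → ℝ)
    (p2 q2 : ℝ≥0∞) (b2 : ℝ → ℝ) : Prop :=
  ∃ C : ℝ≥0∞, C < ∞ ∧ ∀ f : X → ℝ, Measurable f →
    lkNorm μ p2 q2 b2 f ≤ C * lkNorm μ p1 q1 b1 f

/-- A rearrangement-invariant quasi-Banach function norm. -/
structure IsRIQuasiBFN {X : Type*} [MeasurableSpace X] (μ : Measure X)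
    (N : (X → ℝ) → ℝ≥0∞) : Prop where
  abs_eq : ∀ f : X → ℝ, Measurable f → N (fun x => |f x|) = N f
  smul : ∀ (a : ℝ) (f : X → ℝ), Measurable f →
    N (fun x => a * f x) = ENNReal.ofReal |a| * N f
  eq_zero_iff : ∀ f : X → ℝ, Measurable f → (N f = 0 ↔ f =ᵐ[μ] 0)
  quasi_add : ∃ C : ℝ≥0∞, C < ∞ ∧ ∀ f g : X → ℝ, Measurable f → Measurable g →
    N (fun x => f x + g x) ≤ C * (N f + N g)
  mono : ∀ f g : X → ℝ, Measurable f → Measurable g →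
    (∀ᵐ x ∂μ, |f x| ≤ |g x|) → N f ≤ N g
  fatou : ∀ (f : ℕ → X → ℝ) (g : X → ℝ), (∀ n, Measurable (f n)) → Measurable g →
    (∀ᵐ x ∂μ, ∀ n, 0 ≤ f n x) → (∀ᵐ x ∂μ, Monotone fun n => f n x) →
    (∀ᵐ x ∂μ, Filter.Tendsto (fun n => f n x) Filter.atTop (nhds (g x))) →
    N g = ⨆ n, N (f n)
  ind_lt_top : ∀ E : Set X, MeasurableSet E → μ E < ∞ →
    N (Set.indicator E fun _ => (1:ℝ)) < ∞
  rearr_inv : ∀ f g : X → ℝ, Measurable f → Measurable g →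
    rearr μ f = rearr μ g → N f = N g

/-- A rearrangement-invariant Banach function norm. -/
structure IsRIBFN {X : Type*} [MeasurableSpace X] (μ : Measure X)
    (N : (X → ℝ) → ℝ≥0∞) : Prop where
  abs_eq : ∀ f : X → ℝ, Measurable f → N (fun x => |f x|) = N f
  smul : ∀ (a : ℝ) (f : X → ℝ), Measurable f →
    N (fun x => a * f x) = ENNReal.ofReal |a| * N f
  eq_zero_iff : ∀ f : X → ℝ, Measurable f → (N f = 0 ↔ f =ᵐ[μ] 0)
  add_le : ∀ f g : X → ℝ, Measurable f → Measurable g →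
    N (fun x => f x + g x) ≤ N f + N g
  mono : ∀ f g : X → ℝ, Measurable f → Measurable g →
    (∀ᵐ x ∂μ, |f x| ≤ |g x|) → N f ≤ N g
  fatou : ∀ (f : ℕ → X → ℝ) (g : X → ℝ), (∀ n, Measurable (f n)) → Measurable g →
    (∀ᵐ x ∂μ, ∀ n, 0 ≤ f n x) → (∀ᵐ x ∂μ, Monotone fun n => f n x) →
    (∀ᵐ x ∂μ, Filter.Tendsto (fun n => f n x) Filter.atTop (nhds (g x))) →
    N g = ⨆ n, N (f n)
  ind_lt_top : ∀ E : Set X, MeasurableSet E → μ E < ∞ →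
    N (Set.indicator E fun _ => (1:ℝ)) < ∞
  integral_le : ∀ E : Set X, MeasurableSet E → μ E < ∞ →
    ∃ C : ℝ≥0∞, C < ∞ ∧ ∀ f : X → ℝ, Measurable f →
      ∫⁻ x in E, ENNReal.ofReal |f x| ∂μ ≤ C * N f
  rearr_inv : ∀ f g : X → ℝ, Measurable f → Measurable g →
    rearr μ f = rearr μ g → N f = N g

end

theorem lqNorm_top_lt_top_iff {S : Set ℝ} {g : ℝ → ℝ≥0∞} :
    lqNorm ∞ S g < ∞ ↔ ∃ M : ℝ≥0∞, M < ∞ ∧ ∀ᵐ t ∂(volume.restrict S), g t ≤ M := by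
  simp only [lqNorm, if_true]
  constructor
  · intro h
    exact ⟨_, h, ae_le_essSup g⟩
  · rintro ⟨M, hM, h⟩
    exact (essSup_le_of_ae_le M h).trans_lt hM

theorem lqNorm_lt_top_iff {q : ℝ≥0∞} (hq : 0 < q) (hq' : q ≠ ∞) {S : Set ℝ} {g : ℝ → ℝ≥0∞} :
    lqNorm q S g < ∞ ↔ ∫⁻ t in S, g t ^ q.toReal < ∞ := by
  have h : 0 < 1 / q.toReal := one_div_pos.2 (ENNReal.toReal_pos hq.ne' hq')
  simp only [lqNorm, if_neg hq']
  exact ENNReal.rpow_lt_top_iff_of_pos h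

theorem lqNorm_lt_top_of_le {q : ℝ≥0∞} (hq : 0 < q) {S T : Set ℝ} (hT : MeasurableSet T)
    (hTS : T ⊆ S) {g h : ℝ → ℝ≥0∞} {c : ℝ≥0∞} (hc : c ≠ ∞) (hgh : ∀ t ∈ T, g t ≤ c * h t)
    (hh : lqNorm q S h < ∞) : lqNorm q T g < ∞ := by
  rcases eq_or_ne q ∞ with rfl | hq'
  · rw [lqNorm_top_lt_top_iff] at *
    obtain ⟨M, hM, H⟩ := hh
    refine ⟨c * M, ENNReal.mul_lt_top hc.lt_top hM, ?_⟩
    filter_upwards [ae_restrict_of_ae_restrict_of_subset hTS H, ae_restrict_mem hT] with t h1 h2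
    exact (hgh t h2).trans (by gcongr)
  · rw [lqNorm_lt_top_iff hq hq'] at *
    calc ∫⁻ t in T, g t ^ q.toReal
        ≤ ∫⁻ t in T, c ^ q.toReal * h t ^ q.toReal := by
          refine setLIntegral_mono' hT fun t ht => ?_
          rw [← ENNReal.mul_rpow_of_nonneg _ _ ENNReal.toReal_nonneg]
          exact ENNReal.rpow_le_rpow (hgh t ht) ENNReal.toReal_nonneg
      _ = c ^ q.toReal * ∫⁻ t in T, h t ^ q.toReal :=
          lintegral_const_mul' _ _ (ENNReal.rpow_ne_top_of_nonneg ENNReal.toReal_nonneg hc)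
      _ ≤ c ^ q.toReal * ∫⁻ t in S, h t ^ q.toReal := by
          gcongr
      _ < ∞ := ENNReal.mul_lt_top
          (ENNReal.rpow_ne_top_of_nonneg ENNReal.toReal_nonneg hc).lt_top hh

theorem lqNorm_Ioi_zero_lt_top {q : ℝ≥0∞} (hq : 0 < q) {g : ℝ → ℝ≥0∞}
    (h0 : lqNorm q (Ioo 0 1) g < ∞) (h1 : lqNorm q (Ioi 1) g < ∞) :
    lqNorm q (Ioi 0) g < ∞ := by
  have hS : (Ioi (0:ℝ)) = Ioo 0 1 ∪ Ici 1 := (Ioo_union_Ici_eq_Ioi one_pos).symm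
  rcases eq_or_ne q ∞ with rfl | hq'
  · rw [lqNorm_top_lt_top_iff] at *
    obtain ⟨M, hM, H⟩ := h0
    obtain ⟨N, hN, K⟩ := h1
    refine ⟨max M N, max_lt hM hN, ?_⟩
    rw [hS, ae_restrict_union_iff, ← restrict_Ioi_eq_restrict_Ici]
    exact ⟨H.mono fun t ht => ht.trans (le_max_left _ _),
      K.mono fun t ht => ht.trans (le_max_right _ _)⟩
  · rw [lqNorm_lt_top_iff hq hq'] at *
    rw [hS]
    refine (lintegral_union_le _ _ _).trans_lt ?_
    rw [← restrict_Ioi_eq_restrict_Ici]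
    exact ENNReal.add_lt_top.2 ⟨h0, h1⟩

theorem ofReal_rpow_sub_inv_rpow {q : ℝ≥0∞} (hq : 0 < q) (hq' : q ≠ ∞) (ε : ℝ) {t : ℝ}
    (ht : 0 < t) :
    ENNReal.ofReal (t ^ (ε - q⁻¹.toReal)) ^ q.toReal
      = ENNReal.ofReal (t ^ (ε * q.toReal - 1)) := by
  have h : 0 < q.toReal := ENNReal.toReal_pos hq.ne' hq'
  rw [ENNReal.ofReal_rpow_of_nonneg (by positivity) h.le, ← Real.rpow_mul ht.le,
    ENNReal.toReal_inv, sub_mul, inv_mul_cancel₀ h.ne']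

theorem lqNorm_rpow_Ioo_lt_top {q : ℝ≥0∞} (hq : 0 < q) {ε : ℝ} (hε : 0 < ε) :
    lqNorm q (Ioo 0 1) (fun t => ENNReal.ofReal (t ^ (ε - q⁻¹.toReal))) < ∞ := by
  rcases eq_or_ne q ∞ with rfl | hq'
  · rw [lqNorm_top_lt_top_iff]
    refine ⟨1, ENNReal.one_lt_top, ?_⟩
    filter_upwards [ae_restrict_mem measurableSet_Ioo] with t ht
    simpa using Real.rpow_le_one ht.1.le ht.2.le hε.le
  · have h : 0 < q.toReal := ENNReal.toReal_pos hq.ne' hq'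
    rw [lqNorm_lt_top_iff hq hq', setLIntegral_congr_fun measurableSet_Ioo
      fun t ht => ofReal_rpow_sub_inv_rpow hq hq' ε ht.1]
    refine IntegrableOn.setLIntegral_lt_top ?_
    rw [intervalIntegral.integrableOn_Ioo_rpow_iff one_pos]
    nlinarith [mul_pos hε h]

theorem lqNorm_rpow_Ioi_lt_top {q : ℝ≥0∞} (hq : 0 < q) {ε : ℝ} (hε : ε < 0) :
    lqNorm q (Ioi 1) (fun t => ENNReal.ofReal (t ^ (ε - q⁻¹.toReal))) < ∞ := by
  rcases eq_or_ne q ∞ with rfl | hq'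
  · rw [lqNorm_top_lt_top_iff]
    refine ⟨1, ENNReal.one_lt_top, ?_⟩
    filter_upwards [ae_restrict_mem measurableSet_Ioi] with t ht
    simpa using Real.rpow_le_one_of_one_le_of_nonpos (le_of_lt ht) hε.le
  · have h : 0 < q.toReal := ENNReal.toReal_pos hq.ne' hq'
    rw [lqNorm_lt_top_iff hq hq', setLIntegral_congr_fun measurableSet_Ioi
      fun t ht => ofReal_rpow_sub_inv_rpow hq hq' ε (one_pos.trans ht)]
    refine IntegrableOn.setLIntegral_lt_top ?_
    rw [integrableOn_Ioi_rpow_iff one_pos]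
    nlinarith [mul_pos (neg_pos.2 hε) h]

theorem not_lqNorm_rpow_Ioi_lt_top {q : ℝ≥0∞} (hq : 0 < q) {ε : ℝ} (hε : 0 < ε) :
    ¬ lqNorm q (Ioi 1) (fun t => ENNReal.ofReal (t ^ (ε - q⁻¹.toReal))) < ∞ := by
  rcases eq_or_ne q ∞ with rfl | hq'
  · rw [lqNorm_top_lt_top_iff]
    rintro ⟨M, hM, H⟩
    obtain ⟨a, ha⟩ := (tendsto_atTop.1 (tendsto_rpow_atTop hε) (M.toReal + 1)).exists_forall_of_atTop
    have hsub : Ioi (max a 1) ⊆ Ioi (1 : ℝ) := Ioi_subset_Ioi (le_max_right _ _)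
    have hF : ∀ᵐ t ∂(volume.restrict (Ioi (max a 1))), False := by
      filter_upwards [ae_restrict_of_ae_restrict_of_subset hsub H,
        ae_restrict_mem measurableSet_Ioi] with t h1 h2
      have h3 := ha t ((le_max_left _ _).trans (le_of_lt h2))
      simp only [ENNReal.inv_top, ENNReal.toReal_zero, sub_zero] at h1
      have h4 := (ENNReal.ofReal_le_iff_le_toReal hM.ne).1 h1
      linarith
    rw [ae_iff] at hF
    simp at hF
  · have h : 0 < q.toReal := ENNReal.toReal_pos hq.ne' hq'
    rw [lqNorm_lt_top_iff hq hq', setLIntegral_congr_fun measurableSet_Ioi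
      fun t ht => ofReal_rpow_sub_inv_rpow hq hq' ε (one_pos.trans ht)]
    intro H
    have hi : IntegrableOn (fun t : ℝ => t ^ (ε * q.toReal - 1)) (Ioi 1) := by
      refine (lintegral_ofReal_ne_top_iff_integrable
        (by fun_prop) ?_).1 H.ne
      filter_upwards [ae_restrict_mem measurableSet_Ioi] with t ht
      exact Real.rpow_nonneg (one_pos.trans ht).le _
    rw [integrableOn_Ioi_rpow_iff one_pos] at hi
    nlinarith [mul_pos hε h]

namespace IsSlowlyVarying

variable {b : ℝ → ℝ}

theorem exists_rpow_mul_le (hb : IsSlowlyVarying b) {ε : ℝ} (hε : 0 < ε) :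
    ∃ K : ℝ, 0 < K ∧ ∀ s t : ℝ, 0 < s → s ≤ t → s ^ ε * b s ≤ K * (t ^ ε * b t) := by
  obtain ⟨-, -, h⟩ := hb
  obtain ⟨⟨f, hf, c, C, hc, hC, hfb⟩, -⟩ := h ε hε
  refine ⟨C / c, by positivity, fun s t hs hst => ?_⟩
  have ht : 0 < t := hs.trans_le hst
  calc s ^ ε * b s ≤ C * f s := (hfb s hs).2
    _ ≤ C * f t := by gcongr; exact hf hs ht hst
    _ = C / c * (c * f t) := by field_simp
    _ ≤ C / c * (t ^ ε * b t) := mul_le_mul_of_nonneg_left (hfb t ht).1 (by positivity)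

theorem exists_rpow_neg_mul_le (hb : IsSlowlyVarying b) {ε : ℝ} (hε : 0 < ε) :
    ∃ K : ℝ, 0 < K ∧ ∀ s t : ℝ, 0 < s → s ≤ t → t ^ (-ε) * b t ≤ K * (s ^ (-ε) * b s) := by
  obtain ⟨-, -, h⟩ := hb
  obtain ⟨-, ⟨f, hf, c, C, hc, hC, hfb⟩⟩ := h ε hε
  refine ⟨C / c, by positivity, fun s t hs hst => ?_⟩
  have ht : 0 < t := hs.trans_le hst
  calc t ^ (-ε) * b t ≤ C * f t := (hfb t ht).2
    _ ≤ C * f s := by gcongr; exact hf hs ht hst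
    _ = C / c * (c * f s) := by field_simp
    _ ≤ C / c * (s ^ (-ε) * b s) := mul_le_mul_of_nonneg_left (hfb s hs).1 (by positivity)

theorem lqNorm_Ioo_lt_top (hb : IsSlowlyVarying b) {q : ℝ≥0∞} (hq : 0 < q) {a : ℝ}
    (ha : 0 < a) :
    lqNorm q (Ioo 0 1) (fun t => ENNReal.ofReal (t ^ (a - q⁻¹.toReal) * b t)) < ∞ := by
  obtain ⟨K, hK, h⟩ := hb.exists_rpow_mul_le (half_pos ha)
  have hb1 : 0 < b 1 := hb.2.1 1 (mem_Ioi.2 one_pos)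
  refine lqNorm_lt_top_of_le hq measurableSet_Ioo subset_rfl
    (c := ENNReal.ofReal (K * b 1)) ENNReal.ofReal_ne_top (fun t ht => ?_)
    (lqNorm_rpow_Ioo_lt_top hq (half_pos ha))
  rw [← ENNReal.ofReal_mul (by positivity)]
  refine ENNReal.ofReal_le_ofReal ?_
  have h1 := h t 1 ht.1 ht.2.le
  rw [Real.one_rpow, one_mul] at h1
  have h2 : t ^ (a - q⁻¹.toReal) = t ^ (a / 2 - q⁻¹.toReal) * t ^ (a / 2) := by
    rw [← Real.rpow_add ht.1]; ring_nf
  have h3 : 0 ≤ t ^ (a / 2 - q⁻¹.toReal) := Real.rpow_nonneg ht.1.le _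
  rw [h2]
  nlinarith [mul_le_mul_of_nonneg_left h1 h3]

theorem lqNorm_Ioi_lt_top (hb : IsSlowlyVarying b) {q : ℝ≥0∞} (hq : 0 < q) {a : ℝ}
    (ha : a < 0) :
    lqNorm q (Ioi 1) (fun t => ENNReal.ofReal (t ^ (a - q⁻¹.toReal) * b t)) < ∞ := by
  obtain ⟨K, hK, h⟩ := hb.exists_rpow_neg_mul_le (ε := -a / 2) (by linarith)
  have hb1 : 0 < b 1 := hb.2.1 1 (mem_Ioi.2 one_pos)
  refine lqNorm_lt_top_of_le hq measurableSet_Ioi subset_rfl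
    (c := ENNReal.ofReal (K * b 1)) ENNReal.ofReal_ne_top (fun t ht => ?_)
    (lqNorm_rpow_Ioi_lt_top hq (ε := a / 2) (by linarith))
  have ht0 : 0 < t := one_pos.trans ht
  rw [← ENNReal.ofReal_mul (by positivity)]
  refine ENNReal.ofReal_le_ofReal ?_
  have h1 := h 1 t one_pos (le_of_lt ht)
  rw [Real.one_rpow, one_mul] at h1
  have h2 : t ^ (a - q⁻¹.toReal) = t ^ (a / 2 - q⁻¹.toReal) * t ^ (-(-a / 2)) := by
    rw [← Real.rpow_add ht0]; ring_nf
  have h3 : 0 ≤ t ^ (a / 2 - q⁻¹.toReal) := Real.rpow_nonneg ht0.le _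
  rw [h2]
  nlinarith [mul_le_mul_of_nonneg_left h1 h3]

theorem not_lqNorm_Ioi_lt_top (hb : IsSlowlyVarying b) {q : ℝ≥0∞} (hq : 0 < q) {a : ℝ}
    (ha : 0 < a) :
    ¬ lqNorm q (Ioi 1) (fun t => ENNReal.ofReal (t ^ (a - q⁻¹.toReal) * b t)) < ∞ := by
  intro H
  obtain ⟨K, hK, h⟩ := hb.exists_rpow_mul_le (half_pos ha)
  have hb1 : 0 < b 1 := hb.2.1 1 (mem_Ioi.2 one_pos)
  refine not_lqNorm_rpow_Ioi_lt_top hq (half_pos ha)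
    (lqNorm_lt_top_of_le hq measurableSet_Ioi subset_rfl
      (c := ENNReal.ofReal (K / b 1)) ENNReal.ofReal_ne_top (fun t ht => ?_) H)
  have ht0 : 0 < t := one_pos.trans ht
  rw [← ENNReal.ofReal_mul (by positivity)]
  refine ENNReal.ofReal_le_ofReal ?_
  have h1 := h 1 t one_pos (le_of_lt ht)
  rw [Real.one_rpow, one_mul] at h1
  have h2 : t ^ (a - q⁻¹.toReal) = t ^ (a / 2 - q⁻¹.toReal) * t ^ (a / 2) := by
    rw [← Real.rpow_add ht0]; ring_nf
  have h3 : 0 ≤ t ^ (a / 2 - q⁻¹.toReal) := Real.rpow_nonneg ht0.le _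
  rw [h2, div_mul_eq_mul_div, le_div_iff₀ hb1]
  nlinarith [mul_le_mul_of_nonneg_left h1 h3]

end IsSlowlyVarying

/-- The functional of `t ↦ min (1, 1/t)`, which is up to constants the maximal function of
the indicator function of a set of positive finite measure. -/
noncomputable def truncWeightNorm (p q : ℝ≥0∞) (b : ℝ → ℝ) : ℝ≥0∞ :=
  lqNorm q (Ioi 0) (fun t => ENNReal.ofReal (t ^ (p⁻¹.toReal - q⁻¹.toReal) * b t) *
    ENNReal.ofReal (min 1 t⁻¹))

theorem truncWeight_eq_of_lt_one {t : ℝ} (ht : t ∈ Ioo (0:ℝ) 1) (x : ℝ) :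
    ENNReal.ofReal x * ENNReal.ofReal (min 1 t⁻¹) = ENNReal.ofReal x := by
  rw [min_eq_left ((one_le_inv₀ ht.1).2 ht.2.le), ENNReal.ofReal_one, mul_one]

theorem truncWeight_eq_of_one_lt {t : ℝ} (ht : t ∈ Ioi (1:ℝ)) (a q b : ℝ) :
    ENNReal.ofReal (t ^ (a - q) * b) * ENNReal.ofReal (min 1 t⁻¹)
      = ENNReal.ofReal (t ^ (a - 1 - q) * b) := by
  have ht0 : 0 < t := one_pos.trans ht
  rw [min_eq_right (inv_le_one_of_one_le₀ (le_of_lt ht)),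
    ← ENNReal.ofReal_mul' (by positivity), sub_right_comm, Real.rpow_sub_one ht0.ne']
  congr 1
  ring

theorem truncWeightNorm_lt_top_iff_split {p q : ℝ≥0∞} (hq : 0 < q) {b : ℝ → ℝ} :
    truncWeightNorm p q b < ∞ ↔
      lqNorm q (Ioo 0 1) (fun t => ENNReal.ofReal (t ^ (p⁻¹.toReal - q⁻¹.toReal) * b t)) < ∞ ∧
      lqNorm q (Ioi 1)
        (fun t => ENNReal.ofReal (t ^ (p⁻¹.toReal - 1 - q⁻¹.toReal) * b t)) < ∞ := by
  constructor
  · intro h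
    refine ⟨lqNorm_lt_top_of_le hq measurableSet_Ioo (fun t ht => ht.1) ENNReal.one_ne_top
        (fun t ht => ?_) h,
      lqNorm_lt_top_of_le hq measurableSet_Ioi (Ioi_subset_Ioi zero_le_one) ENNReal.one_ne_top
        (fun t ht => ?_) h⟩
    · rw [one_mul, truncWeight_eq_of_lt_one ht]
    · rw [one_mul, truncWeight_eq_of_one_lt ht]
  · rintro ⟨h0, h1⟩
    refine lqNorm_Ioi_zero_lt_top hq
      (lqNorm_lt_top_of_le hq measurableSet_Ioo subset_rfl ENNReal.one_ne_top
        (fun t ht => ?_) h0)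
      (lqNorm_lt_top_of_le hq measurableSet_Ioi subset_rfl ENNReal.one_ne_top
        (fun t ht => ?_) h1)
    · rw [one_mul, truncWeight_eq_of_lt_one ht]
    · rw [one_mul, truncWeight_eq_of_one_lt ht]

theorem truncWeightNorm_lt_top_iff {p q : ℝ≥0∞} (hp : 0 < p) (hq : 0 < q) {b : ℝ → ℝ}
    (hb : IsSlowlyVarying b) :
    truncWeightNorm p q b < ∞ ↔
      ((1 < p ∧ p < ∞) ∨
       (p = 1 ∧ weightNorm ∞ q b (Set.Ioi 1) < ∞) ∨
       (p = ∞ ∧ weightNorm ∞ q b (Set.Ioo 0 1) < ∞)) := by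
  rw [truncWeightNorm_lt_top_iff_split hq]
  rcases eq_or_ne p ∞ with rfl | hp'
  · simp only [weightNorm, ENNReal.inv_top, ENNReal.toReal_zero, lt_self_iff_false, and_false,
      ENNReal.top_ne_one, false_and, true_and, false_or]
    exact and_iff_left (hb.lqNorm_Ioi_lt_top hq (by norm_num))
  have hpos : 0 < p.toReal := ENNReal.toReal_pos hp.ne' hp'
  rw [and_iff_right (hb.lqNorm_Ioo_lt_top hq (by rw [ENNReal.toReal_inv]; positivity))]
  rcases lt_trichotomy p 1 with h1 | rfl | h1
  · have h : 0 < p⁻¹.toReal - 1 := by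
      rw [ENNReal.toReal_inv, sub_pos]
      refine (one_lt_inv₀ hpos).2 ?_
      simpa using (ENNReal.toReal_lt_toReal hp' ENNReal.one_ne_top).2 h1
    simp only [hb.not_lqNorm_Ioi_lt_top hq h, false_iff]
    simp [h1.ne, h1.not_gt, hp']
  · simp [weightNorm]
  · have h : p⁻¹.toReal - 1 < 0 := by
      rw [ENNReal.toReal_inv, sub_neg]
      refine inv_lt_one_of_one_lt₀ ?_
      simpa using (ENNReal.toReal_lt_toReal ENNReal.one_ne_top hp').2 h1
    simp only [hb.lqNorm_Ioi_lt_top hq h, true_iff]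
    exact Or.inl ⟨h1, hp'.lt_top⟩

section Rearrangement

variable {X : Type*} [MeasurableSpace X] {μ : Measure X}

theorem le_rearr {f : X → ℝ} {s : ℝ≥0∞} {t : ℝ}
    (h : ENNReal.ofReal t < μ {x | s < ENNReal.ofReal |f x|}) : s ≤ rearr μ f t := by
  refine le_sInf fun r hr => ?_
  by_contra! hrs
  exact (h.trans_le (measure_mono fun x (hx : s < _) => hrs.trans hx)).not_ge hr

theorem exists_lt_measure_of_not_ae_eq_zero {f : X → ℝ} (hf : ¬ f =ᵐ[μ] 0) :
    ∃ s t : ℝ, 0 < s ∧ 0 < t ∧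
      ENNReal.ofReal t < μ {x | ENNReal.ofReal s < ENNReal.ofReal |f x|} := by
  have h : ∃ n : ℕ, μ {x | ENNReal.ofReal (1 / ((n : ℝ) + 1)) < ENNReal.ofReal |f x|} ≠ 0 := by
    by_contra! h
    refine hf ((ae_iff.2 (measure_mono_null (fun x hx => ?_) (measure_iUnion_null h))))
    obtain ⟨n, hn⟩ := exists_nat_one_div_lt (abs_pos.2 hx)
    exact mem_iUnion.2 ⟨n, (ENNReal.ofReal_lt_ofReal_iff (abs_pos.2 hx)).2 hn⟩
  obtain ⟨n, hn⟩ := h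
  obtain ⟨r, -, hr0, hr⟩ := ENNReal.lt_iff_exists_real_btwn.1 (pos_iff_ne_zero.2 hn)
  exact ⟨1 / ((n : ℝ) + 1), r, by positivity, ENNReal.ofReal_pos.1 hr0, hr⟩

theorem exists_le_maxf {f : X → ℝ} (hf : ¬ f =ᵐ[μ] 0) :
    ∃ c : ℝ, 0 < c ∧ ∀ t, 0 < t → ENNReal.ofReal (min 1 t⁻¹) ≤ ENNReal.ofReal c * maxf μ f t := by
  obtain ⟨s, r, hs, hr, h⟩ := exists_lt_measure_of_not_ae_eq_zero hf
  refine ⟨(s * min 1 r)⁻¹, by positivity, fun t ht => ?_⟩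
  have hint : ENNReal.ofReal (s * min t r) ≤ ∫⁻ u in Ioo (0:ℝ) t, rearr μ f u := by
    calc ENNReal.ofReal (s * min t r) = ∫⁻ u in Ioo (0:ℝ) (min t r), ENNReal.ofReal s := by
          rw [setLIntegral_const, Real.volume_Ioo, sub_zero, ENNReal.ofReal_mul hs.le]
      _ ≤ ∫⁻ u in Ioo (0:ℝ) (min t r), rearr μ f u := by
          refine setLIntegral_mono' measurableSet_Ioo fun u hu => le_rearr ?_
          exact (ENNReal.ofReal_le_ofReal (hu.2.le.trans (min_le_right _ _))).trans_lt h
      _ ≤ ∫⁻ u in Ioo (0:ℝ) t, rearr μ f u :=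
          lintegral_mono_set (Ioo_subset_Ioo_right (min_le_left _ _))
  have hmin : min 1 r * min 1 t⁻¹ ≤ t⁻¹ * min t r := by
    rw [mul_min_of_nonneg _ _ (by positivity : 0 ≤ t⁻¹), inv_mul_cancel₀ ht.ne', mul_comm t⁻¹]
    refine le_min (mul_le_one₀ (min_le_left _ _) (by positivity) (min_le_left _ _)) ?_
    exact mul_le_mul (min_le_right _ _) (min_le_right _ _) (by positivity) hr.le
  calc ENNReal.ofReal (min 1 t⁻¹)
      ≤ ENNReal.ofReal ((s * min 1 r)⁻¹ * (t⁻¹ * (s * min t r))) := by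
        refine ENNReal.ofReal_le_ofReal ?_
        rw [← div_eq_inv_mul, le_div_iff₀ (by positivity)]
        nlinarith [mul_le_mul_of_nonneg_left hmin hs.le]
    _ = ENNReal.ofReal (s * min 1 r)⁻¹ *
          ((ENNReal.ofReal t)⁻¹ * ENNReal.ofReal (s * min t r)) := by
        rw [ENNReal.ofReal_mul (by positivity), ENNReal.ofReal_mul (by positivity),
          ENNReal.ofReal_inv_of_pos ht]
    _ ≤ ENNReal.ofReal (s * min 1 r)⁻¹ * maxf μ f t := by
        unfold maxf
        gcongr

theorem rearr_indicator_le (E : Set X) (t : ℝ) :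
    rearr μ (E.indicator fun _ => (1:ℝ)) t
      ≤ {u : ℝ | ENNReal.ofReal u < μ E}.indicator (fun _ => 1) t := by
  by_cases h : ENNReal.ofReal t < μ E
  · rw [indicator_of_mem (show t ∈ {u : ℝ | ENNReal.ofReal u < μ E} from h)]
    refine sInf_le ?_
    have : {x | 1 < ENNReal.ofReal |E.indicator (fun _ => (1:ℝ)) x|} = ∅ := by
      ext x
      by_cases hx : x ∈ E <;> simp [hx]
    rw [mem_ofPred_eq, this, measure_empty]
    exact zero_le
  · rw [indicator_of_notMem (show t ∉ {u : ℝ | ENNReal.ofReal u < μ E} from h)]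
    refine sInf_le ((measure_mono fun x hx => ?_).trans (not_lt.1 h))
    by_contra hxE
    simp [hxE] at hx

theorem maxf_indicator_le {E : Set X} (hE : μ E < ∞) {t : ℝ} (ht : 0 < t) :
    maxf μ (E.indicator fun _ => (1:ℝ)) t
      ≤ ENNReal.ofReal (max 1 (μ E).toReal) * ENNReal.ofReal (min 1 t⁻¹) := by
  set m := (μ E).toReal with hm
  have hmn : 0 ≤ m := ENNReal.toReal_nonneg
  have hint : ∫⁻ u in Ioo (0:ℝ) t, rearr μ (E.indicator fun _ => (1:ℝ)) u
      ≤ ENNReal.ofReal (min t m) := by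
    calc ∫⁻ u in Ioo (0:ℝ) t, rearr μ (E.indicator fun _ => (1:ℝ)) u
        ≤ ∫⁻ u in Ioo (0:ℝ) t, (Ioo 0 m).indicator (fun _ => 1) u := by
          refine setLIntegral_mono' measurableSet_Ioo fun u hu =>
            (rearr_indicator_le E u).trans (indicator_apply_le' (fun h => ?_) fun _ => zero_le)
          have hum : u ∈ Ioo 0 m := ⟨hu.1, (ENNReal.ofReal_lt_iff_lt_toReal hu.1.le hE.ne).1 h⟩
          rw [indicator_of_mem hum]
      _ ≤ ENNReal.ofReal (min t m) := by
          rw [lintegral_indicator measurableSet_Ioo, Measure.restrict_restrict measurableSet_Ioo,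
            setLIntegral_const, one_mul, Ioo_inter_Ioo, Real.volume_Ioo]
          simp [min_comm]
  calc maxf μ (E.indicator fun _ => (1:ℝ)) t
      ≤ (ENNReal.ofReal t)⁻¹ * ENNReal.ofReal (min t m) := by unfold maxf; gcongr
    _ = ENNReal.ofReal (t⁻¹ * min t m) := by
        rw [← ENNReal.ofReal_inv_of_pos ht, ← ENNReal.ofReal_mul (by positivity)]
    _ ≤ ENNReal.ofReal (max 1 m * min 1 t⁻¹) := by
        refine ENNReal.ofReal_le_ofReal ?_
        rw [mul_min_of_nonneg _ _ (by positivity), mul_min_of_nonneg _ _ (by positivity),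
          inv_mul_cancel₀ ht.ne', mul_one, mul_comm]
        exact min_le_min (le_max_left _ _) (by gcongr; exact le_max_right _ _)
    _ = _ := ENNReal.ofReal_mul (by positivity)

theorem truncWeightNorm_lt_top_of_lkMaxNorm_lt_top {p q : ℝ≥0∞} (hq : 0 < q) {b : ℝ → ℝ}
    {f : X → ℝ} (hf : ¬ f =ᵐ[μ] 0) (h : lkMaxNorm μ p q b f < ∞) :
    truncWeightNorm p q b < ∞ := by
  obtain ⟨c, -, hcf⟩ := exists_le_maxf hf
  refine lqNorm_lt_top_of_le hq measurableSet_Ioi subset_rfl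
    (ENNReal.ofReal_ne_top (r := c)) (fun t ht => ?_) h
  rw [mul_left_comm]
  gcongr
  exact hcf t ht

theorem lkMaxNorm_indicator_lt_top {p q : ℝ≥0∞} (hq : 0 < q) {b : ℝ → ℝ} {E : Set X}
    (hE : μ E < ∞) (h : truncWeightNorm p q b < ∞) :
    lkMaxNorm μ p q b (E.indicator fun _ => (1:ℝ)) < ∞ := by
  refine lqNorm_lt_top_of_le hq measurableSet_Ioi subset_rfl
    (ENNReal.ofReal_ne_top (r := max 1 (μ E).toReal)) (fun t ht => ?_) h
  rw [mul_left_comm]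
  gcongr
  exact maxf_indicator_le hE ht

end Rearrangement

/-- Proposition PP4: characterisation of property (P4) for
`‖·‖_{(p,q,b)}`; otherwise `L^{(p,q,b)}` is trivial. -/
theorem lkMaxNorm_P4_iff {X : Type*} [MeasurableSpace X] (μ : Measure X)
    [SigmaFinite μ] (hna : IsNonatomic μ) (hμ : μ Set.univ = ∞)
    (p q : ℝ≥0∞) (hp : 0 < p) (hq : 0 < q) (b : ℝ → ℝ) (hb : IsSlowlyVarying b) :
    ((∀ E : Set X, MeasurableSet E → μ E < ∞ →
        lkMaxNorm μ p q b (Set.indicator E fun _ => (1:ℝ)) < ∞) ↔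
      ((1 < p ∧ p < ∞) ∨
       (p = 1 ∧ weightNorm ∞ q b (Set.Ioi 1) < ∞) ∨
       (p = ∞ ∧ weightNorm ∞ q b (Set.Ioo 0 1) < ∞))) ∧
    (¬((1 < p ∧ p < ∞) ∨
       (p = 1 ∧ weightNorm ∞ q b (Set.Ioi 1) < ∞) ∨
       (p = ∞ ∧ weightNorm ∞ q b (Set.Ioo 0 1) < ∞)) →
      ∀ f : X → ℝ, Measurable f → lkMaxNorm μ p q b f < ∞ → f =ᵐ[μ] 0) := by
  rw [← truncWeightNorm_lt_top_iff hp hq hb]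
  refine ⟨⟨fun h => ?_, fun h E _ hE => lkMaxNorm_indicator_lt_top hq hE h⟩, fun h f _ hf => ?_⟩
  · obtain ⟨E, hE, hE0, hEtop⟩ : ∃ E, MeasurableSet E ∧ 0 < μ E ∧ μ E < ∞ := by
      obtain ⟨E, hE, -, hE0, hEtop⟩ := Measure.exists_subset_measure_lt_top (μ := μ) (r := 0)
        MeasurableSet.univ (by simp [hμ])
      exact ⟨E, hE, hE0, hEtop⟩
    refine truncWeightNorm_lt_top_of_lkMaxNorm_lt_top hq (fun h0 => hE0.ne' ?_) (h E hE hEtop)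
    rw [indicator_ae_eq_zero] at h0
    simpa [Function.support_const] using h0
  · by_contra hf0
    exact h (truncWeightNorm_lt_top_of_lkMaxNorm_lt_top hq hf0 hf)
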